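/- arXiv:2412.05017 — 2 statements merged into one kernel-verified Lean document; each statement's English description precedes it below -/
import Mathlib

section
/- Let a_1,…,a_n be positive integers with Σ_{i=1}^n a_i = 2C. Then there exists a subset A ⊆ {1,…,n} with Σ_{i∈A} a_i = C if and only if the infimum of the costs of feasible solutions to DLSPp equals n + C. (That is, the partition problem instance is solved by solving DLSPp.) -/
/-- Core level `J i` determined by returns `R` and remanufacturing decisions `x`:
`J 1 = R 1`, `J (i+1) = J i + R (i+1) - x i`. -/
def coreLevel (R x : ℕ → ℤ) : ℕ → ℤ
  | 0 => 0
  | 1 => R 1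
  | (i + 2) => coreLevel R x (i + 1) + R (i + 2) - x (i + 1)

/-- Serviceable inventory level `I i`: `I 1 = 0`, `I (i+1) = I i + x i + y i - D i`. -/
def servLevel (D x y : ℕ → ℤ) : ℕ → ℤ
  | 0 => 0
  | 1 => 0
  | (i + 2) => servLevel D x y (i + 1) + x (i + 1) + y (i + 1) - D (i + 1)

/-- Feasibility of `(x, y)` for the dynamic lot sizing problem with `N` periods,
demands `D` and returns `R`. -/
def Feasible (N : ℕ) (D R x y : ℕ → ℤ) : Prop :=
  ∀ i : ℕ, 1 ≤ i → i ≤ N →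
    0 ≤ x i ∧ 0 ≤ y i ∧ x i ≤ coreLevel R x i ∧ 0 ≤ servLevel D x y (i + 1)

/-- Total cost of a solution `(x, y)` of the dynamic lot sizing problem. -/
def cost (N : ℕ) (D R Kr Km hs hc cr cm x y : ℕ → ℤ) : ℤ :=
  ∑ i ∈ Finset.Icc 1 N,
    (Kr i * (if 0 < x i then 1 else 0) + Km i * (if 0 < y i then 1 else 0)
      + cr i * x i + cm i * y i + hc i * (coreLevel R x i - x i)
      + hs i * servLevel D x y (i + 1))

/-- Returns for the DLSPp instance: `R 1 = C`, `R i = 0` for `i ≠ 1`. -/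
def ppR (C : ℤ) : ℕ → ℤ := fun i => if i = 1 then C else 0

theorem coreLevel_ppR_succ (C : ℤ) (x : ℕ → ℤ) (m : ℕ) :
    coreLevel (ppR C) x (m + 1) = C - ∑ i ∈ Finset.Icc 1 m, x i := by
  induction m with
  | zero => simp [coreLevel, ppR]
  | succ k ih =>
    rw [coreLevel, ih, Finset.sum_Icc_succ_top (by omega)]
    simp only [ppR]
    rw [if_neg (by omega)]
    ring

theorem servLevel_succ (D x y : ℕ → ℤ) {i : ℕ} (hi : 1 ≤ i) :
    servLevel D x y (i + 1) = servLevel D x y i + x i + y i - D i := by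
  obtain ⟨k, rfl⟩ := Nat.exists_eq_add_of_le' hi
  rfl

theorem servLevel_succ_eq_sum (D x y : ℕ → ℤ) (m : ℕ) :
    servLevel D x y (m + 1) = ∑ i ∈ Finset.Icc 1 m, x i + ∑ i ∈ Finset.Icc 1 m, y i
      - ∑ i ∈ Finset.Icc 1 m, D i := by
  induction m with
  | zero => simp [servLevel]
  | succ k ih =>
    rw [servLevel, ih]
    simp only [Finset.sum_Icc_succ_top (show 1 ≤ k + 1 by omega)]
    ring

theorem Feasible.servLevel_nonneg {N : ℕ} {D R x y : ℕ → ℤ} (h : Feasible N D R x y)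
    {i : ℕ} (hi : i ≤ N + 1) : 0 ≤ servLevel D x y i := by
  match i, hi with
  | 0, _ => exact le_rfl
  | 1, _ => exact le_rfl
  | k + 2, hi => exact (h (k + 1) (by omega) (by omega)).2.2.2

/-- Remanufacturing in a DLSPp instance is bounded by the initial stock of cores. -/
theorem Feasible.sum_le {n : ℕ} (hn : 1 ≤ n) {a x y : ℕ → ℤ} {C : ℤ}
    (h : Feasible n a (ppR C) x y) : ∑ i ∈ Finset.Icc 1 n, x i ≤ C := by
  obtain ⟨k, rfl⟩ := Nat.exists_eq_add_of_le' hn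
  have hx := (h (k + 1) (by omega) le_rfl).2.2.1
  rw [coreLevel_ppR_succ] at hx
  rw [Finset.sum_Icc_succ_top (by omega)]
  linarith

/-- Number of setups in period `i`, minus the at least `1 - servLevel i` that are necessary. -/
def excessSetups (D x y : ℕ → ℤ) (i : ℕ) : ℤ :=
  (if 0 < x i then 1 else 0) + (if 0 < y i then 1 else 0) - 1 + servLevel D x y i

theorem Feasible.excessSetups_nonneg {N : ℕ} {D R x y : ℕ → ℤ} (h : Feasible N D R x y)
    (hD : ∀ i : ℕ, 1 ≤ i → i ≤ N → 0 < D i) {i : ℕ} (hi : 1 ≤ i) (hiN : i ≤ N) :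
    0 ≤ excessSetups D x y i := by
  have hs := h.servLevel_nonneg (i := i) (by omega)
  obtain ⟨hx, hy, -, hs'⟩ := h i hi hiN
  have hDi := hD i hi hiN
  rw [servLevel_succ D x y hi] at hs'
  unfold excessSetups
  split_ifs <;> omega

theorem cost_ppR_eq (n : ℕ) (a : ℕ → ℤ) (C : ℤ) (x y : ℕ → ℤ) :
    cost n a (ppR C) (fun _ => 1) (fun _ => 1) (fun _ => 3) (fun _ => 0)
        (fun _ => 0) (fun _ => 1) x y =
      n + ∑ i ∈ Finset.Icc 1 n, y i + servLevel a x y (n + 1)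
        + 2 * ∑ i ∈ Finset.Icc 1 n, servLevel a x y (i + 1)
        + ∑ i ∈ Finset.Icc 1 n, excessSetups a x y i := by
  unfold cost
  induction n with
  | zero => simp [servLevel]
  | succ k ih =>
    simp only [Finset.sum_Icc_succ_top (show 1 ≤ k + 1 by omega), ih]
    simp only [excessSetups]
    push_cast
    ring

theorem Feasible.add_le_cost {n : ℕ} (hn : 1 ≤ n) {a x y : ℕ → ℤ} {C : ℤ}
    (ha : ∀ i : ℕ, 1 ≤ i → i ≤ n → 0 < a i)
    (hsum : ∑ i ∈ Finset.Icc 1 n, a i = 2 * C) (h : Feasible n a (ppR C) x y) :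
    (n : ℤ) + C ≤ cost n a (ppR C) (fun _ => 1) (fun _ => 1) (fun _ => 3) (fun _ => 0)
        (fun _ => 0) (fun _ => 1) x y := by
  rw [cost_ppR_eq]
  have hx := h.sum_le hn
  have hI := h.servLevel_nonneg le_rfl
  have hI' := servLevel_succ_eq_sum a x y n
  have hs : 0 ≤ ∑ i ∈ Finset.Icc 1 n, servLevel a x y (i + 1) :=
    Finset.sum_nonneg fun i hi => h.servLevel_nonneg (by grind)
  have he : 0 ≤ ∑ i ∈ Finset.Icc 1 n, excessSetups a x y i :=
    Finset.sum_nonneg fun i hi => h.excessSetups_nonneg ha (by grind) (by grind)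
  linarith

theorem Feasible.exists_subset_of_cost_eq {n : ℕ} (hn : 1 ≤ n) {a x y : ℕ → ℤ} {C : ℤ}
    (ha : ∀ i : ℕ, 1 ≤ i → i ≤ n → 0 < a i)
    (hsum : ∑ i ∈ Finset.Icc 1 n, a i = 2 * C) (h : Feasible n a (ppR C) x y)
    (hcost : cost n a (ppR C) (fun _ => 1) (fun _ => 1) (fun _ => 3) (fun _ => 0)
        (fun _ => 0) (fun _ => 1) x y = n + C) :
    ∃ A : Finset ℕ, A ⊆ Finset.Icc 1 n ∧ ∑ i ∈ A, a i = C := by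
  rw [cost_ppR_eq] at hcost
  have hx := h.sum_le hn
  have hI := h.servLevel_nonneg le_rfl
  have hI' := servLevel_succ_eq_sum a x y n
  have hs0 : ∀ i ∈ Finset.Icc 1 n, 0 ≤ servLevel a x y (i + 1) :=
    fun i hi => h.servLevel_nonneg (by grind)
  have he0 : ∀ i ∈ Finset.Icc 1 n, 0 ≤ excessSetups a x y i :=
    fun i hi => h.excessSetups_nonneg ha (by grind) (by grind)
  have hs := Finset.sum_nonneg hs0
  have he := Finset.sum_nonneg he0
  have hs1 := (Finset.sum_eq_zero_iff_of_nonneg hs0).1 (by linarith)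
  have he1 := (Finset.sum_eq_zero_iff_of_nonneg he0).1 (by linarith)
  have hxC : ∑ i ∈ Finset.Icc 1 n, x i = C := by linarith
  refine ⟨(Finset.Icc 1 n).filter fun i => 0 < x i, Finset.filter_subset _ _, ?_⟩
  rw [Finset.sum_filter, ← hxC]
  refine Finset.sum_congr rfl fun i hi => ?_
  obtain ⟨h1, h2⟩ := Finset.mem_Icc.1 hi
  obtain ⟨hxi, hyi, -, -⟩ := h i h1 h2
  have hIi : servLevel a x y i = 0 := by
    obtain rfl | h1 := h1.eq_or_lt
    · rfl
    · have := hs1 (i - 1) (by grind)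
      rwa [Nat.sub_add_cancel (by omega)] at this
  have e1 := hs1 i hi
  have e2 := he1 i hi
  rw [servLevel_succ a x y h1, hIi] at e1
  rw [excessSetups, hIi] at e2
  split_ifs at e2 ⊢ <;> omega

theorem exists_feasible_cost_eq {n : ℕ} {a : ℕ → ℤ} {C : ℤ}
    (ha : ∀ i : ℕ, 1 ≤ i → i ≤ n → 0 < a i)
    (hsum : ∑ i ∈ Finset.Icc 1 n, a i = 2 * C)
    {A : Finset ℕ} (hA : A ⊆ Finset.Icc 1 n) (hAC : ∑ i ∈ A, a i = C) :
    ∃ x y : ℕ → ℤ, Feasible n a (ppR C) x y ∧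
      cost n a (ppR C) (fun _ => 1) (fun _ => 1) (fun _ => 3) (fun _ => 0)
        (fun _ => 0) (fun _ => 1) x y = n + C := by
  set x : ℕ → ℤ := fun i => if i ∈ A then a i else 0 with hx
  set y : ℕ → ℤ := fun i => if i ∈ A then 0 else a i with hy
  have hxy : ∀ i, x i + y i = a i := fun i => by simp only [hx, hy]; split_ifs <;> simp
  have hI : ∀ m, servLevel a x y (m + 1) = 0 := fun m => by
    rw [servLevel_succ_eq_sum, ← Finset.sum_add_distrib, Finset.sum_congr rfl fun i _ => hxy i,
      sub_self]
  have hx0 : ∀ i ∈ Finset.Icc 1 n, 0 ≤ x i := fun i hi => by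
    have := ha i (by grind) (by grind)
    simp only [hx]; split_ifs <;> omega
  have hxC : ∑ i ∈ Finset.Icc 1 n, x i = C := by
    rw [← hAC, ← Finset.sum_filter, Finset.filter_mem_eq_inter, Finset.inter_eq_right.2 hA]
  refine ⟨x, y, fun i h1 h2 => ⟨hx0 i (by grind), ?_, ?_, (hI i).ge⟩, ?_⟩
  · have := ha i h1 h2
    simp only [hy]; split_ifs <;> omega
  · obtain ⟨k, rfl⟩ := Nat.exists_eq_add_of_le' h1
    have : ∑ i ∈ Finset.Icc 1 (k + 1), x i ≤ ∑ i ∈ Finset.Icc 1 n, x i :=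
      Finset.sum_le_sum_of_subset_of_nonneg (Finset.Icc_subset_Icc_right h2)
        fun i hi _ => hx0 i hi
    rw [Finset.sum_Icc_succ_top (by omega)] at this
    rw [coreLevel_ppR_succ]
    linarith
  · have he : ∑ i ∈ Finset.Icc 1 n, excessSetups a x y i = 0 :=
      Finset.sum_eq_zero fun i hi => by
        obtain ⟨h1, h2⟩ := Finset.mem_Icc.1 hi
        obtain ⟨k, rfl⟩ := Nat.exists_eq_add_of_le' h1
        have := ha _ h1 h2
        rw [excessSetups, hI]
        by_cases hk : k + 1 ∈ A <;> simp [hx, hy, hk, this]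
    have hs := servLevel_succ_eq_sum a x y n
    rw [hI] at hs
    rw [cost_ppR_eq, he, hI, Finset.sum_eq_zero fun i _ => hI i]
    linarith

/-- The partition instance has a solution iff the infimum of the costs of feasible
solutions to DLSPp equals `n + C`. -/
theorem stmt3 (n : ℕ) (hn : 1 ≤ n) (a : ℕ → ℤ) (C : ℤ)
    (ha : ∀ i : ℕ, 1 ≤ i → i ≤ n → 0 < a i)
    (hsum : ∑ i ∈ Finset.Icc 1 n, a i = 2 * C) :
    (∃ A : Finset ℕ, A ⊆ Finset.Icc 1 n ∧ ∑ i ∈ A, a i = C) ↔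
      sInf {c : ℤ | ∃ x y : ℕ → ℤ, Feasible n a (ppR C) x y ∧
        cost n a (ppR C) (fun _ => 1) (fun _ => 1) (fun _ => 3) (fun _ => 0)
          (fun _ => 0) (fun _ => 1) x y = c} = (n : ℤ) + C := by
  have hbdd : ∀ c ∈ {c : ℤ | ∃ x y : ℕ → ℤ, Feasible n a (ppR C) x y ∧
      cost n a (ppR C) (fun _ => 1) (fun _ => 1) (fun _ => 3) (fun _ => 0)
        (fun _ => 0) (fun _ => 1) x y = c}, (n : ℤ) + C ≤ c := by
    rintro _ ⟨x, y, h, rfl⟩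
    exact h.add_le_cost hn ha hsum
  constructor
  · rintro ⟨A, hA, hAC⟩
    exact IsLeast.csInf_eq ⟨exists_feasible_cost_eq ha hsum hA hAC, hbdd⟩
  · intro hinf
    have hC : 0 ≤ ∑ i ∈ Finset.Icc 1 n, a i :=
      Finset.sum_nonneg fun i hi => (ha i (by grind) (by grind)).le
    have hne : {c : ℤ | ∃ x y : ℕ → ℤ, Feasible n a (ppR C) x y ∧
        cost n a (ppR C) (fun _ => 1) (fun _ => 1) (fun _ => 3) (fun _ => 0)
          (fun _ => 0) (fun _ => 1) x y = c}.Nonempty := by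
      by_contra hempty
      rw [Set.not_nonempty_iff_eq_empty.1 hempty, Int.csInf_empty] at hinf
      omega
    have hmem := Int.csInf_mem hne ⟨_, hbdd⟩
    rw [hinf] at hmem
    obtain ⟨x, y, h, hcost⟩ := hmem
    exact h.exists_subset_of_cost_eq hn ha hsum hcost
end

section
/- Consider a DLSP whose parameters satisfy Assumption 1 (and recall D_i > 0 for all i). Then every optimal solution (x*, y*) satisfies I*_i = 0 for all i = 1,…,N+1 and x*_i + y*_i = D_i for all i = 1,…,N; that is, in each period one produces exactly enough to satisfy that period's demand. -/
/-- Postpone one unit of production `z` from period `i` to period `i + 1`. -/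
def postpone (z : ℕ → ℤ) (i j : ℕ) : ℤ :=
  z j - (if j = i then 1 else 0) + (if j = i + 1 then 1 else 0)

lemma coreLevel_postpone (R x : ℕ → ℤ) {i : ℕ} (hi : 1 ≤ i) (j : ℕ) :
    coreLevel R (postpone x i) j = coreLevel R x j + (if j = i + 1 then 1 else 0) := by
  fun_induction coreLevel R x j with
  | case1 => simp [coreLevel]
  | case2 => simp [coreLevel]; omega
  | case3 k ih =>
    simp only [coreLevel, ih, postpone]
    split_ifs <;> omega

lemma servLevel_postpone_left (D x y : ℕ → ℤ) {i : ℕ} (hi : 1 ≤ i) (j : ℕ) :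
    servLevel D (postpone x i) y j = servLevel D x y j - (if j = i + 1 then 1 else 0) := by
  fun_induction servLevel D x y j with
  | case1 => simp [servLevel]
  | case2 => simp [servLevel]; omega
  | case3 k ih =>
    simp only [servLevel, ih, postpone]
    split_ifs <;> omega

lemma servLevel_comm (D x y : ℕ → ℤ) (j : ℕ) : servLevel D x y j = servLevel D y x j := by
  fun_induction servLevel D x y j with
  | case1 => rfl
  | case2 => rfl
  | case3 k ih => simp only [servLevel, ih]; ring

lemma servLevel_postpone_right (D x y : ℕ → ℤ) {i : ℕ} (hi : 1 ≤ i) (j : ℕ) :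
    servLevel D x (postpone y i) j = servLevel D x y j - (if j = i + 1 then 1 else 0) := by
  rw [servLevel_comm, servLevel_postpone_left D y x hi, servLevel_comm]

lemma Feasible.postpone_left {N : ℕ} {D R x y : ℕ → ℤ} (h : Feasible N D R x y) {i : ℕ}
    (hi : 1 ≤ i) (hx : 0 < x i) (hI : 0 < servLevel D x y (i + 1)) :
    Feasible N D R (postpone x i) y := by
  intro j h1 hj
  obtain ⟨hxj, hyj, hJ, hIj⟩ := h j h1 hj
  rw [coreLevel_postpone R x hi, servLevel_postpone_left D x y hi]
  by_cases hji : j = i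
  · subst hji
    simp [postpone]
    omega
  · simp only [postpone, hji, if_false, Nat.add_right_cancel_iff]
    split_ifs <;> omega

lemma Feasible.postpone_right {N : ℕ} {D R x y : ℕ → ℤ} (h : Feasible N D R x y) {i : ℕ}
    (hi : 1 ≤ i) (hy : 0 < y i) (hI : 0 < servLevel D x y (i + 1)) :
    Feasible N D R x (postpone y i) := by
  intro j h1 hj
  obtain ⟨hxj, hyj, hJ, hIj⟩ := h j h1 hj
  rw [servLevel_postpone_right D x y hi]
  by_cases hji : j = i
  · subst hji
    simp [postpone]
    omega
  · simp only [postpone, hji, if_false, Nat.add_right_cancel_iff]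
    split_ifs <;> omega

lemma sum_Icc_lt_of_postpone {N i : ℕ} {f g : ℕ → ℤ} {a b : ℤ} (h1 : 1 ≤ i) (hi : i ≤ N)
    (hb : 0 ≤ b) (hab : b < a)
    (h : ∀ j ∈ Finset.Icc 1 N,
      f j ≤ g j - (if j = i then a else 0) + (if j = i + 1 then b else 0)) :
    ∑ j ∈ Finset.Icc 1 N, f j < ∑ j ∈ Finset.Icc 1 N, g j := by
  have hsum := Finset.sum_le_sum h
  have hmem : i ∈ Finset.Icc 1 N := Finset.mem_Icc.2 ⟨h1, hi⟩
  rw [Finset.sum_add_distrib, Finset.sum_sub_distrib, Finset.sum_ite_eq', Finset.sum_ite_eq',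
    if_pos hmem] at hsum
  split_ifs at hsum <;> omega

lemma setup_postpone_le {K c : ℕ → ℤ} (z : ℕ → ℤ) (i j : ℕ) (hK : 0 ≤ K j) :
    K j * (if 0 < postpone z i j then 1 else 0) + c j * postpone z i j ≤
      K j * (if 0 < z j then 1 else 0) + c j * z j
        - (if j = i then c i else 0) + (if j = i + 1 then K (i + 1) + c (i + 1) else 0) := by
  by_cases hji : j = i
  · subst hji
    simp only [postpone, if_true, Nat.left_eq_add, one_ne_zero, if_false]
    split_ifs <;> first | omega | nlinarith
  · by_cases hji' : j = i + 1
    · subst hji'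
      simp only [postpone, if_true, hji, if_false]
      split_ifs <;> first | omega | nlinarith
    · simp [postpone, hji, hji']

lemma cost_postpone_left_lt {N : ℕ} {D R Kr Km hs hc cr cm x y : ℕ → ℤ} {i : ℕ}
    (h1 : 1 ≤ i) (hi : i ≤ N) (hKr : ∀ j, 1 ≤ j → j ≤ N → 0 ≤ Kr j)
    (hnext : 0 ≤ Kr (i + 1) + cr (i + 1))
    (hass : Kr (i + 1) + hc i + cr (i + 1) < hs i + cr i) :
    cost N D R Kr Km hs hc cr cm (postpone x i) y < cost N D R Kr Km hs hc cr cm x y := by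
  refine sum_Icc_lt_of_postpone (a := hs i + cr i - hc i) h1 hi hnext (by linarith) ?_
  intro j hj
  rw [Finset.mem_Icc] at hj
  have hset := setup_postpone_le (c := cr) x i j (hKr j hj.1 hj.2)
  rw [coreLevel_postpone R x h1, servLevel_postpone_left D x y h1]
  have hcore : hc j * (coreLevel R x j + (if j = i + 1 then 1 else 0) - postpone x i j) =
      hc j * (coreLevel R x j - x j) + (if j = i then hc i else 0) := by
    rw [postpone]
    by_cases hji : j = i
    · subst hji; simp; ring
    · simp [hji]
  have hserv : hs j * (servLevel D x y (j + 1) - (if j + 1 = i + 1 then 1 else 0)) =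
      hs j * servLevel D x y (j + 1) - (if j = i then hs i else 0) := by
    by_cases hji : j = i
    · subst hji; simp; ring
    · simp [hji]
  rw [hcore, hserv]
  by_cases hji : j = i
  · simp only [hji, if_true] at hset ⊢
    linarith
  · simp only [hji, if_false] at hset ⊢
    linarith

lemma cost_postpone_right_lt {N : ℕ} {D R Kr Km hs hc cr cm x y : ℕ → ℤ} {i : ℕ}
    (h1 : 1 ≤ i) (hi : i ≤ N) (hKm : ∀ j, 1 ≤ j → j ≤ N → 0 ≤ Km j)
    (hnext : 0 ≤ Km (i + 1) + cm (i + 1))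
    (hass : Km (i + 1) + cm (i + 1) < hs i + cm i) :
    cost N D R Kr Km hs hc cr cm x (postpone y i) < cost N D R Kr Km hs hc cr cm x y := by
  refine sum_Icc_lt_of_postpone h1 hi hnext hass ?_
  intro j hj
  rw [Finset.mem_Icc] at hj
  have hset := setup_postpone_le (c := cm) y i j (hKm j hj.1 hj.2)
  rw [servLevel_postpone_right D x y h1]
  have hserv : hs j * (servLevel D x y (j + 1) - (if j + 1 = i + 1 then 1 else 0)) =
      hs j * servLevel D x y (j + 1) - (if j = i then hs i else 0) := by
    by_cases hji : j = i
    · subst hji; simp; ring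
    · simp [hji]
  rw [hserv]
  by_cases hji : j = i
  · simp only [hji, if_true] at hset ⊢
    linarith
  · simp only [hji, if_false] at hset ⊢
    linarith

/-- For a DLSP satisfying Assumption 1, every optimal solution satisfies `I*_i = 0`
for all `i = 1, …, N+1`, and `x*_i + y*_i = D_i` for all `i = 1, …, N`. -/
theorem stmt6 (N : ℕ) (hN : 1 ≤ N) (D R Kr Km hs hc cr cm : ℕ → ℤ)
    (hD : ∀ i : ℕ, 1 ≤ i → i ≤ N → 0 < D i)
    (hR : ∀ i : ℕ, 1 ≤ i → i ≤ N → 0 ≤ R i)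
    (hKr : ∀ i : ℕ, 1 ≤ i → i ≤ N → 0 ≤ Kr i)
    (hKm : ∀ i : ℕ, 1 ≤ i → i ≤ N → 0 ≤ Km i)
    (hhs : ∀ i : ℕ, 1 ≤ i → i ≤ N → 0 ≤ hs i)
    (hhc : ∀ i : ℕ, 1 ≤ i → i ≤ N → 0 ≤ hc i)
    (hcr : ∀ i : ℕ, 1 ≤ i → i ≤ N → 0 ≤ cr i)
    (hcm : ∀ i : ℕ, 1 ≤ i → i ≤ N → 0 ≤ cm i)
    (hRN : R (N + 1) = 0) (hKrN : Kr (N + 1) = 0) (hKmN : Km (N + 1) = 0)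
    (hcrN : cr (N + 1) = 0) (hcmN : cm (N + 1) = 0)
    (hass1 : ∀ i : ℕ, 1 ≤ i → i ≤ N → Km (i + 1) + cm (i + 1) < hs i + cm i)
    (hass2 : ∀ i : ℕ, 1 ≤ i → i ≤ N → Kr (i + 1) + hc i + cr (i + 1) < hs i + cr i)
    (x y : ℕ → ℤ)
    (hfeas : Feasible N D R x y)
    (hopt : ∀ x' y' : ℕ → ℤ, Feasible N D R x' y' →
      cost N D R Kr Km hs hc cr cm x y ≤ cost N D R Kr Km hs hc cr cm x' y') :
    (∀ i : ℕ, 1 ≤ i → i ≤ N + 1 → servLevel D x y i = 0) ∧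
    (∀ i : ℕ, 1 ≤ i → i ≤ N → x i + y i = D i) := by
  have hnext : ∀ {f : ℕ → ℤ}, (∀ j, 1 ≤ j → j ≤ N → 0 ≤ f j) → f (N + 1) = 0 →
      ∀ i, i ≤ N → 0 ≤ f (i + 1) := by
    intro f hf hfN i hi
    rcases hi.eq_or_lt with rfl | hlt
    · exact hfN.ge
    · exact hf _ (by omega) hlt
  have hserv_succ : ∀ i, 1 ≤ i →
      servLevel D x y (i + 1) = servLevel D x y i + x i + y i - D i := by
    intro i hi
    obtain ⟨k, rfl⟩ := Nat.exists_eq_add_of_le' hi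
    rfl
  have hzero : ∀ i, 1 ≤ i → i ≤ N + 1 → servLevel D x y i = 0 := by
    intro i h1
    induction i, h1 using Nat.le_induction with
    | base => exact fun _ => rfl
    | succ i h1 ih =>
      intro hi
      replace hi : i ≤ N := by omega
      obtain ⟨hxi, hyi, -, hI⟩ := hfeas i h1 hi
      by_contra hne
      have hpos : 0 < servLevel D x y (i + 1) := by omega
      have hstep := hserv_succ i h1
      have hDi := hD i h1 hi
      rw [ih (by omega)] at hstep
      rcases hxi.lt_or_eq with hx | hx
      · exact (hopt _ _ (hfeas.postpone_left h1 hx hpos)).not_gt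
          (cost_postpone_left_lt h1 hi hKr
            (add_nonneg (hnext hKr hKrN i hi) (hnext hcr hcrN i hi)) (hass2 i h1 hi))
      · exact (hopt _ _ (hfeas.postpone_right h1 (by omega) hpos)).not_gt
          (cost_postpone_right_lt h1 hi hKm
            (add_nonneg (hnext hKm hKmN i hi) (hnext hcm hcmN i hi)) (hass1 i h1 hi))
  refine ⟨hzero, fun i h1 hi => ?_⟩
  have hstep := hserv_succ i h1
  rw [hzero i h1 (by omega), hzero (i + 1) (by omega) (by omega)] at hstep
  omega
end
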